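/- arXiv:1508.06713 — 9 statements merged into one kernel-verified Lean document; each statement's English description precedes it below -/
import Mathlib

section
/- The reduction relation →_SF of SF-calculus is confluent: if M →*_SF N₁ and M →*_SF N₂, then there exists a term P with N₁ →*_SF P and N₂ →*_SF P. -/
/-- Terms of SF-calculus: two atoms `S` and `F` and binary application. -/
inductive SF where
  | S : SF
  | F : SF
  | app : SF → SF → SF

/-- Factorable forms: partially applied combinators. -/
def SF.Factorable : SF → Prop
  | .S => True
  | .F => True
  | .app .S _ => True
  | .app .F _ => True
  | .app (.app .S _) _ => True
  | .app (.app .F _) _ => True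
  | _ => False

/-- One-step reduction of SF-calculus, closed under contexts. -/
inductive SF.Red : SF → SF → Prop
  | sred (M N X : SF) :
      SF.Red (app (app (app S M) N) X) (app (app M X) (app N X))
  | fatomS (M N : SF) : SF.Red (app (app (app F S) M) N) M
  | fatomF (M N : SF) : SF.Red (app (app (app F F) M) N) M
  | fcomp (P Q M N : SF) : (SF.app P Q).Factorable →
      SF.Red (app (app (app F (app P Q)) M) N) (app (app N P) Q)
  | appL {M M' : SF} (N : SF) : SF.Red M M' → SF.Red (app M N) (app M' N)
  | appR (M : SF) {N N' : SF} : SF.Red N N' → SF.Red (app M N) (app M N')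

namespace SF

/-- Parallel reduction: contract simultaneously any set of redexes already present in a term. -/
inductive Par : SF → SF → Prop
  | S : Par S S
  | F : Par F F
  | app {M M' N N' : SF} : Par M M' → Par N N' → Par (app M N) (app M' N')
  | sred {M M' N N' X X' : SF} : Par M M' → Par N N' → Par X X' →
      Par (.app (.app (.app .S M) N) X) (.app (.app M' X') (.app N' X'))
  | fatomS {M M' : SF} (N : SF) : Par M M' → Par (.app (.app (.app .F .S) M) N) M'
  | fatomF {M M' : SF} (N : SF) : Par M M' → Par (.app (.app (.app .F .F) M) N) M'
  | fcomp {P P' Q Q' N N' : SF} (M : SF) : (SF.app P Q).Factorable →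
      Par P P' → Par Q Q' → Par N N' →
      Par (.app (.app (.app .F (.app P Q)) M) N) (.app (.app N' P') Q')

namespace Par

theorem refl (M : SF) : Par M M := by
  induction M with
  | S => exact .S
  | F => exact .F
  | app _ _ ihM ihN => exact .app ihM ihN

theorem of_red {M N : SF} (h : Red M N) : Par M N := by
  induction h with
  | sred M N X => exact .sred (refl M) (refl N) (refl X)
  | fatomS M N => exact .fatomS N (refl M)
  | fatomF M N => exact .fatomF N (refl M)
  | fcomp P Q M N hf => exact .fcomp M hf (refl P) (refl Q) (refl N)
  | appL N _ ih => exact .app ih (refl N)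
  | appR M _ ih => exact .app (refl M) ih

theorem eq_S {M : SF} (h : Par .S M) : M = .S := by
  cases h; rfl

theorem eq_F {M : SF} (h : Par .F M) : M = .F := by
  cases h; rfl

/-- The root of a compound factorable form is never contracted. -/
theorem app_inv {P Q R : SF} (h : Par (.app P Q) R) (hf : (SF.app P Q).Factorable) :
    ∃ P' Q', R = .app P' Q' ∧ Par P P' ∧ Par Q Q' := by
  cases h with
  | app hP hQ => exact ⟨_, _, rfl, hP, hQ⟩
  | sred | fatomS | fatomF | fcomp => exact hf.elim

theorem S_app_inv {M R : SF} (h : Par (.app .S M) R) :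
    ∃ M', R = .app .S M' ∧ Par M M' := by
  obtain ⟨_, M', rfl, hS, hM⟩ := h.app_inv trivial
  cases hS.eq_S
  exact ⟨M', rfl, hM⟩

theorem F_app_inv {M R : SF} (h : Par (.app .F M) R) :
    ∃ M', R = .app .F M' ∧ Par M M' := by
  obtain ⟨_, M', rfl, hF, hM⟩ := h.app_inv trivial
  cases hF.eq_F
  exact ⟨M', rfl, hM⟩

theorem S_app_app_inv {M N R : SF} (h : Par (.app (.app .S M) N) R) :
    ∃ M' N', R = .app (.app .S M') N' ∧ Par M M' ∧ Par N N' := by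
  obtain ⟨_, N', rfl, hS, hN⟩ := h.app_inv trivial
  obtain ⟨M', rfl, hM⟩ := hS.S_app_inv
  exact ⟨M', N', rfl, hM, hN⟩

theorem F_app_app_inv {M N R : SF} (h : Par (.app (.app .F M) N) R) :
    ∃ M' N', R = .app (.app .F M') N' ∧ Par M M' ∧ Par N N' := by
  obtain ⟨_, N', rfl, hF, hN⟩ := h.app_inv trivial
  obtain ⟨M', rfl, hM⟩ := hF.F_app_inv
  exact ⟨M', N', rfl, hM, hN⟩

theorem factorable {M N : SF} (h : Par M N) (hf : M.Factorable) : N.Factorable := by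
  match M, hf with
  | .S, _ => cases h.eq_S; trivial
  | .F, _ => cases h.eq_F; trivial
  | .app .S _, _ => obtain ⟨_, rfl, _⟩ := h.S_app_inv; trivial
  | .app .F _, _ => obtain ⟨_, rfl, _⟩ := h.F_app_inv; trivial
  | .app (.app .S _) _, _ => obtain ⟨_, _, rfl, _⟩ := h.S_app_app_inv; trivial
  | .app (.app .F _) _, _ => obtain ⟨_, _, rfl, _⟩ := h.F_app_app_inv; trivial

/-- The diamond property passes from the components of an application to the application, when one
of the two steps leaves the root uncontracted. -/
theorem diamond_app {L L' N N' R : SF} (hL : Par L L')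
    (ihL : ∀ K, Par L K → ∃ D, Par L' D ∧ Par K D)
    (ihN : ∀ K, Par N K → ∃ D, Par N' D ∧ Par K D)
    (h : Par (.app L N) R) : ∃ D, Par (.app L' N') D ∧ Par R D := by
  cases h with
  | app hL₂ hN₂ =>
    obtain ⟨D, h₁, h₂⟩ := ihL _ hL₂
    obtain ⟨E, k₁, k₂⟩ := ihN _ hN₂
    exact ⟨_, .app h₁ k₁, .app h₂ k₂⟩
  | sred hA hB hX =>
    obtain ⟨X, hX₁, hX₂⟩ := ihN _ hX
    obtain ⟨D, h₁, h₂⟩ := ihL _ (.app (.app .S hA) hB)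
    obtain ⟨A, B, rfl, hA₂, hB₂⟩ := h₂.S_app_app_inv
    obtain ⟨A', B', rfl, -, -⟩ := hL.S_app_app_inv
    obtain ⟨_, _, ⟨⟩, hA₁, hB₁⟩ := h₁.S_app_app_inv
    exact ⟨_, .sred hA₁ hB₁ hX₁, .app (.app hA₂ hX₂) (.app hB₂ hX₂)⟩
  | fatomS _ hA =>
    obtain ⟨D, h₁, h₂⟩ := ihL _ (.app (.app .F .S) hA)
    obtain ⟨C, A, rfl, hC₂, hA₂⟩ := h₂.F_app_app_inv
    obtain ⟨C', A', rfl, hC, -⟩ := hL.F_app_app_inv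
    obtain ⟨_, _, ⟨⟩, -, hA₁⟩ := h₁.F_app_app_inv
    cases hC.eq_S
    exact ⟨_, .fatomS _ hA₁, hA₂⟩
  | fatomF _ hA =>
    obtain ⟨D, h₁, h₂⟩ := ihL _ (.app (.app .F .F) hA)
    obtain ⟨C, A, rfl, hC₂, hA₂⟩ := h₂.F_app_app_inv
    obtain ⟨C', A', rfl, hC, -⟩ := hL.F_app_app_inv
    obtain ⟨_, _, ⟨⟩, -, hA₁⟩ := h₁.F_app_app_inv
    cases hC.eq_F
    exact ⟨_, .fatomF _ hA₁, hA₂⟩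
  | fcomp M hf hP hQ hX =>
    obtain ⟨X, hX₁, hX₂⟩ := ihN _ hX
    obtain ⟨D, h₁, h₂⟩ := ihL _ (.app (.app .F (.app hP hQ)) (refl M))
    obtain ⟨C, A, rfl, hC₂, -⟩ := h₂.F_app_app_inv
    obtain ⟨P, Q, rfl, hP₂, hQ₂⟩ := hC₂.app_inv ((Par.app hP hQ).factorable hf)
    obtain ⟨C', A', rfl, hC, -⟩ := hL.F_app_app_inv
    obtain ⟨P', Q', rfl, -, -⟩ := hC.app_inv hf
    obtain ⟨_, _, ⟨⟩, hC₁, -⟩ := h₁.F_app_app_inv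
    obtain ⟨_, _, ⟨⟩, hP₁, hQ₁⟩ := hC₁.app_inv (hC.factorable hf)
    exact ⟨_, .fcomp A' (hC.factorable hf) hP₁ hQ₁ hX₁, .app (.app hX₂ hP₂) hQ₂⟩

theorem diamond {M N₁ N₂ : SF} (h₁ : Par M N₁) (h₂ : Par M N₂) :
    ∃ P, Par N₁ P ∧ Par N₂ P := by
  induction h₁ generalizing N₂ with
  | S => exact ⟨_, h₂, refl _⟩
  | F => exact ⟨_, h₂, refl _⟩
  | app hL _ ihL ihN => exact diamond_app hL (fun _ => ihL) (fun _ => ihN) h₂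
  | sred _ _ _ ihA ihB ihX =>
    cases h₂ with
    | app hL hX =>
      obtain ⟨_, _, rfl, hA, hB⟩ := hL.S_app_app_inv
      obtain ⟨A, hA₁, hA₂⟩ := ihA hA
      obtain ⟨B, hB₁, hB₂⟩ := ihB hB
      obtain ⟨X, hX₁, hX₂⟩ := ihX hX
      exact ⟨_, .app (.app hA₁ hX₁) (.app hB₁ hX₁), .sred hA₂ hB₂ hX₂⟩
    | sred hA hB hX =>
      obtain ⟨A, hA₁, hA₂⟩ := ihA hA
      obtain ⟨B, hB₁, hB₂⟩ := ihB hB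
      obtain ⟨X, hX₁, hX₂⟩ := ihX hX
      exact ⟨_, .app (.app hA₁ hX₁) (.app hB₁ hX₁), .app (.app hA₂ hX₂) (.app hB₂ hX₂)⟩
  | fatomS _ _ ih =>
    cases h₂ with
    | app hL _ =>
      obtain ⟨_, _, rfl, hS, hA⟩ := hL.F_app_app_inv
      cases hS.eq_S
      obtain ⟨A, hA₁, hA₂⟩ := ih hA
      exact ⟨A, hA₁, .fatomS _ hA₂⟩
    | fatomS _ hA => exact ih hA
  | fatomF _ _ ih =>
    cases h₂ with
    | app hL _ =>
      obtain ⟨_, _, rfl, hF, hA⟩ := hL.F_app_app_inv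
      cases hF.eq_F
      obtain ⟨A, hA₁, hA₂⟩ := ih hA
      exact ⟨A, hA₁, .fatomF _ hA₂⟩
    | fatomF _ hA => exact ih hA
  | fcomp _ hf _ _ _ ihP ihQ ihX =>
    cases h₂ with
    | app hL hX =>
      obtain ⟨_, _, rfl, hC, -⟩ := hL.F_app_app_inv
      obtain ⟨_, _, rfl, hP, hQ⟩ := hC.app_inv hf
      obtain ⟨P, hP₁, hP₂⟩ := ihP hP
      obtain ⟨Q, hQ₁, hQ₂⟩ := ihQ hQ
      obtain ⟨X, hX₁, hX₂⟩ := ihX hX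
      exact ⟨_, .app (.app hX₁ hP₁) hQ₁, .fcomp _ (hC.factorable hf) hP₂ hQ₂ hX₂⟩
    | fcomp _ _ hP hQ hX =>
      obtain ⟨P, hP₁, hP₂⟩ := ihP hP
      obtain ⟨Q, hQ₁, hQ₂⟩ := ihQ hQ
      obtain ⟨X, hX₁, hX₂⟩ := ihX hX
      exact ⟨_, .app (.app hX₁ hP₁) hQ₁, .app (.app hX₂ hP₂) hQ₂⟩

end Par

open Relation

theorem reds_app {M M' N N' : SF} (hM : ReflTransGen Red M M') (hN : ReflTransGen Red N N') :
    ReflTransGen Red (.app M N) (.app M' N') :=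
  (hM.lift (SF.app · N) fun _ _ => .appL N).trans (hN.lift (SF.app M') fun _ _ => .appR M')

theorem Par.reds {M N : SF} (h : Par M N) : ReflTransGen Red M N := by
  induction h with
  | S => exact .refl
  | F => exact .refl
  | app _ _ ihM ihN => exact reds_app ihM ihN
  | sred _ _ _ ihM ihN ihX =>
    exact .head (.sred _ _ _) (reds_app (reds_app ihM ihX) (reds_app ihN ihX))
  | fatomS N _ ih => exact .head (.fatomS _ N) ih
  | fatomF N _ ih => exact .head (.fatomF _ N) ih
  | fcomp M hf _ _ _ ihP ihQ ihN =>
    exact .head (.fcomp _ _ M _ hf) (reds_app (reds_app ihN ihP) ihQ)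

theorem reflTransGen_par : ReflTransGen Par = ReflTransGen Red :=
  le_antisymm (reflTransGen_closed fun _ _ => Par.reds)
    (ReflTransGen.mono fun _ _ => Par.of_red)

end SF

/-- The reduction relation of SF-calculus is confluent. -/
theorem SF.red_confluent {M N₁ N₂ : SF}
    (h₁ : Relation.ReflTransGen SF.Red M N₁)
    (h₂ : Relation.ReflTransGen SF.Red M N₂) :
    ∃ P : SF, Relation.ReflTransGen SF.Red N₁ P ∧ Relation.ReflTransGen SF.Red N₂ P := by
  rw [← reflTransGen_par] at h₁ h₂ ⊢
  refine Relation.church_rosser (fun _ _ _ hb hc => ?_) h₁ h₂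
  obtain ⟨D, hD₁, hD₂⟩ := hb.diamond hc
  exact ⟨D, .single hD₁, .single hD₂⟩
end

section
/- Define a translation ⟪·⟫ from Combinatory Logic to SF-calculus by ⟪S⟫ = S, ⟪K⟫ = F F, and ⟪M N⟫ = ⟪M⟫ ⟪N⟫. Then (i) if M →_CL N in one step then ⟪M⟫ reduces to ⟪N⟫ in one or more →_SF steps, and (ii) if M is strongly normalising with respect to →_CL then ⟪M⟫ is strongly normalising with respect to →_SF. -/
/-- Terms of Combinatory Logic (SK-calculus). -/
inductive CL where
  | S : CL
  | K : CL
  | app : CL → CL → CL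

/-- One-step reduction of Combinatory Logic, closed under contexts. -/
inductive CL.Red : CL → CL → Prop
  | sred (M N X : CL) :
      CL.Red (app (app (app S M) N) X) (app (app M X) (app N X))
  | kred (M N : CL) : CL.Red (app (app K M) N) M
  | appL {M M' : CL} (N : CL) : CL.Red M M' → CL.Red (app M N) (app M' N)
  | appR (M : CL) {N N' : CL} : CL.Red N N' → CL.Red (app M N) (app M N')

/-- A term is strongly normalising w.r.t. a reduction relation `r` if it
admits no infinite reduction sequence. -/
def SN {α : Type*} (r : α → α → Prop) (a : α) : Prop :=
  ¬ ∃ f : ℕ → α, f 0 = a ∧ ∀ n, r (f n) (f (n + 1))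

/-- The translation from Combinatory Logic to SF-calculus:
`⟪S⟫ = S`, `⟪K⟫ = F F`, `⟪M N⟫ = ⟪M⟫ ⟪N⟫`. -/
def clToSF : CL → SF
  | .S => .S
  | .K => .app .F .F
  | .app M N => .app (clToSF M) (clToSF N)

theorem clToSF_transGen {M N : CL} (h : CL.Red M N) :
    Relation.TransGen SF.Red (clToSF M) (clToSF N) := by
  induction h with
  | sred M N X => exact .single (.sred _ _ _)
  | kred M N => exact .single (.fatomF _ _)
  | appL N _ ih => exact ih.lift (fun M => SF.app M (clToSF N)) fun _ _ => .appL _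
  | appR M _ ih => exact ih.lift (fun N => SF.app (clToSF M) N) fun _ _ => .appR _

theorem clToSF_ne_F (t : CL) : clToSF t ≠ SF.F := by
  cases t <;> simp [clToSF]

theorem clToSF_eq_S {t : CL} (h : clToSF t = SF.S) : t = .S := by
  cases t <;> simp_all [clToSF]

theorem clToSF_eq_app {t : CL} {a b : SF} (h : clToSF t = .app a b) :
    (t = .K ∧ a = .F ∧ b = .F) ∨ ∃ u v, t = .app u v ∧ clToSF u = a ∧ clToSF v = b := by
  cases t <;> simp_all [clToSF, eq_comm]

/-- Every reduction step from a translated term is the translation of a CL-step. -/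
theorem clToSF_reflects_red {a b : SF} (h : SF.Red a b) :
    ∀ t : CL, clToSF t = a → ∃ t', CL.Red t t' ∧ clToSF t' = b := by
  induction h with
  | sred M N X =>
    intro t ht
    obtain ⟨-, h, -⟩ | ⟨u, X', rfl, hu, rfl⟩ := clToSF_eq_app ht
    · simp at h
    obtain ⟨-, h, -⟩ | ⟨v, N', rfl, hv, rfl⟩ := clToSF_eq_app hu
    · simp at h
    obtain ⟨-, h, -⟩ | ⟨w, M', rfl, hw, rfl⟩ := clToSF_eq_app hv
    · simp at h
    obtain rfl := clToSF_eq_S hw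
    exact ⟨_, .sred _ _ _, rfl⟩
  | fatomS M N =>
    intro t ht
    obtain ⟨-, h, -⟩ | ⟨u, N', rfl, hu, rfl⟩ := clToSF_eq_app ht
    · simp at h
    obtain ⟨-, h, -⟩ | ⟨v, M', rfl, hv, rfl⟩ := clToSF_eq_app hu
    · simp at h
    obtain ⟨-, -, h⟩ | ⟨w, -, rfl, hw, -⟩ := clToSF_eq_app hv
    · simp at h
    · exact absurd hw (clToSF_ne_F w)
  | fatomF M N =>
    intro t ht
    obtain ⟨-, h, -⟩ | ⟨u, N', rfl, hu, rfl⟩ := clToSF_eq_app ht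
    · simp at h
    obtain ⟨-, h, -⟩ | ⟨v, M', rfl, hv, rfl⟩ := clToSF_eq_app hu
    · simp at h
    obtain ⟨rfl, -, -⟩ | ⟨w, -, rfl, hw, -⟩ := clToSF_eq_app hv
    · exact ⟨_, .kred _ _, rfl⟩
    · exact absurd hw (clToSF_ne_F w)
  | fcomp P Q M N _ =>
    intro t ht
    obtain ⟨-, h, -⟩ | ⟨u, N', rfl, hu, rfl⟩ := clToSF_eq_app ht
    · simp at h
    obtain ⟨-, h, -⟩ | ⟨v, M', rfl, hv, rfl⟩ := clToSF_eq_app hu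
    · simp at h
    obtain ⟨-, -, h⟩ | ⟨w, -, rfl, hw, -⟩ := clToSF_eq_app hv
    · simp at h
    · exact absurd hw (clToSF_ne_F w)
  | appL N hr ih =>
    intro t ht
    obtain ⟨-, rfl, -⟩ | ⟨u, v, rfl, hu, rfl⟩ := clToSF_eq_app ht
    · cases hr
    obtain ⟨u', hred, rfl⟩ := ih u hu
    exact ⟨_, .appL _ hred, rfl⟩
  | appR M hr ih =>
    intro t ht
    obtain ⟨-, -, rfl⟩ | ⟨u, v, rfl, rfl, hv⟩ := clToSF_eq_app ht
    · cases hr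
    obtain ⟨v', hred, rfl⟩ := ih v hv
    exact ⟨_, .appR _ hred, rfl⟩

/-- Strong normalisation transfers along a map whose image reflects reduction steps. -/
theorem SN.map_of_reflects {α β : Type*} {r : α → α → Prop} {s : β → β → Prop} {φ : α → β}
    (hφ : ∀ a b, s (φ a) b → ∃ a', r a a' ∧ φ a' = b) {a : α} (ha : SN r a) : SN s (φ a) := by
  rintro ⟨f, hf0, hf⟩
  have step : ∀ n (x : {x // φ x = f n}), ∃ y : {y // φ y = f (n + 1)}, r x y := by
    rintro n ⟨x, hx⟩
    obtain ⟨y, hxy, hy⟩ := hφ x (f (n + 1)) (hx ▸ hf n)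
    exact ⟨⟨y, hy⟩, hxy⟩
  choose next hnext using step
  let g : ∀ n, {x // φ x = f n} := fun n => Nat.rec ⟨a, hf0.symm⟩ next n
  exact ha ⟨fun n => (g n).1, rfl, fun n => hnext n (g n)⟩

/-- The translation of CL into SF-calculus preserves reduction (each CL-step is
simulated by one or more SF-steps) and strong normalisation. -/
theorem cl_to_sf_faithful :
    (∀ M N : CL, CL.Red M N →
       Relation.TransGen SF.Red (clToSF M) (clToSF N)) ∧
    (∀ M : CL, SN CL.Red M → SN SF.Red (clToSF M)) :=
  ⟨fun _ _ h => clToSF_transGen h,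
    fun _ h => h.map_of_reflects fun a _ hs => clToSF_reflects_red hs a rfl⟩
end

section
/- There exists an SF-term T such that for every SF-normal form X, T (S (F F) X) →*_SF X. Hence SF-calculus can discriminate between extensionally equal terms: all the terms S (F F) X represent the identity function, yet T distinguishes them by recovering X. -/
/-- An SF-normal form: a term admitting no reduction step. -/
def SF.NormalForm (M : SF) : Prop := ¬ ∃ N : SF, SF.Red M N

/-- The combinator `K`, discarding its second argument. -/
def SF.const : SF := .app .F .F

/-- The identity combinator `S K K`. -/
def SF.ident : SF := .app (.app .S SF.const) SF.const

/-- The combinator `λ z, F z S (K I)`, recovering the argument of a compound `z`. -/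
def SF.rightComponent : SF :=
  .app (.app .S (.app (.app .S .F) (.app SF.const .S))) (.app SF.const (.app SF.const SF.ident))

theorem SF.rightComponent_app {P Q : SF} (h : (SF.app P Q).Factorable) :
    Relation.ReflTransGen SF.Red (.app SF.rightComponent (.app P Q)) Q :=
  .head (.sred _ _ _) <| .head (.appL _ (.sred _ _ _)) <| .head (.fcomp _ _ _ _ h) <|
    .head (.appL _ (.appL _ (.fatomF _ _))) <| .head (.appL _ (.fatomF _ _)) <|
    .head (.sred _ _ _) <| .head (.fatomF _ _) .refl

/-- There is an SF-term `T` which distinguishes the extensionally equal identity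
terms `I_X := S (F F) X`: for every SF-normal form `X`, `T I_X →*_SF X`. -/
theorem exists_discriminator :
    ∃ T : SF, ∀ X : SF, X.NormalForm →
      Relation.ReflTransGen SF.Red
        (SF.app T (SF.app (SF.app SF.S (SF.app SF.F SF.F)) X)) X :=
  ⟨SF.rightComponent, fun _ _ => SF.rightComponent_app trivial⟩
end

section
/- The structural equality predicate on normal forms is not representable in Combinatory Logic: there is no CL-term E such that for all CL-normal forms X and Y, E X Y →*_CL K if X and Y are syntactically identical, and E X Y →*_CL S K otherwise. -/
/-- A CL-normal form: a term admitting no reduction step. -/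
def CL.NormalForm (M : CL) : Prop := ¬ ∃ N : CL, CL.Red M N

/-- Points of Engeler's graph model: a base point, together with step functions from finite
collections of points to points. -/
inductive GraphPt where
  | base : GraphPt
  | arrow : List GraphPt → GraphPt → GraphPt

namespace GraphPt

/-- The set of points occurring in a list. -/
def ofList (l : List GraphPt) : Set GraphPt := {a | a ∈ l}

/-- Application in the graph model. -/
def app (M N : Set GraphPt) : Set GraphPt := {b | ∃ l, ofList l ⊆ N ∧ arrow l b ∈ M}

/-- The interpretation of the combinator `K`. -/
def k : Set GraphPt := {p | ∃ l m b, p = arrow l (arrow m b) ∧ b ∈ l}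

/-- The interpretation of the combinator `S`. -/
def s : Set GraphPt :=
  {p | ∃ l m n b, p = arrow l (arrow m (arrow n b)) ∧
    b ∈ app (app (ofList l) (ofList n)) (app (ofList m) (ofList n))}

theorem app_mono {M M' N N' : Set GraphPt} (hM : M ⊆ M') (hN : N ⊆ N') :
    app M N ⊆ app M' N' :=
  fun _ ⟨l, hl, hb⟩ => ⟨l, hl.trans hN, hM hb⟩

theorem ofList_append (l m : List GraphPt) : ofList (l ++ m) = ofList l ∪ ofList m := by
  ext a
  simp [ofList]

theorem ofList_singleton_subset {a : GraphPt} {M : Set GraphPt} (h : a ∈ M) :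
    ofList [a] ⊆ M := by
  simpa [ofList] using h

theorem ofList_nil_subset (M : Set GraphPt) : ofList [] ⊆ M := by
  simp [ofList]

/-- Application is continuous in both arguments jointly. -/
theorem exists_ofList_subset_app (M N : Set GraphPt) (l : List GraphPt)
    (h : ofList l ⊆ app M N) :
    ∃ m n, ofList m ⊆ M ∧ ofList n ⊆ N ∧ ofList l ⊆ app (ofList m) (ofList n) := by
  induction l with
  | nil => exact ⟨[], [], ofList_nil_subset _, ofList_nil_subset _, ofList_nil_subset _⟩
  | cons a l ih =>
    obtain ⟨m, n, hm, hn, hl⟩ := ih fun x hx => h (List.mem_cons_of_mem _ hx)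
    obtain ⟨n', hn', ha⟩ := h (show a ∈ ofList (a :: l) from List.mem_cons_self)
    refine ⟨arrow n' a :: m, n' ++ n, ?_, ?_, ?_⟩
    · intro x hx
      rcases List.mem_cons.1 hx with rfl | hx
      exacts [ha, hm hx]
    · rw [ofList_append]
      exact Set.union_subset hn' hn
    · rw [ofList_append]
      intro x hx
      rcases List.mem_cons.1 hx with rfl | hx
      · exact ⟨n', Set.subset_union_left, List.mem_cons_self⟩
      · exact app_mono (fun y hy => List.mem_cons_of_mem _ hy) Set.subset_union_right (hl hx)

theorem app_app_k (M N : Set GraphPt) : app (app k M) N = M := by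
  ext b
  constructor
  · rintro ⟨m, -, l, hl, l', m', b', h, hb⟩
    cases h
    exact hl hb
  · intro hb
    exact ⟨[], ofList_nil_subset _, [b], ofList_singleton_subset hb, [b], [], b, rfl,
      List.mem_cons_self⟩

theorem app_app_s (M N : Set GraphPt) :
    app (app s M) N =
      {p | ∃ n b, p = arrow n b ∧ b ∈ app (app M (ofList n)) (app N (ofList n))} := by
  ext p
  constructor
  · rintro ⟨m, hm, l, hl, l', m', n, b, h, hb⟩
    cases h
    exact ⟨n, b, rfl, app_mono (app_mono hl le_rfl) (app_mono hm le_rfl) hb⟩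
  · rintro ⟨n, b, rfl, l, hl, n', hn', hb⟩
    obtain ⟨m, n'', hm, hn'', hl⟩ := exists_ofList_subset_app _ _ _ hl
    exact ⟨m, hm, [arrow n' (arrow l b)], ofList_singleton_subset hb, _, m, n, b, rfl,
      l, hl.trans (app_mono le_rfl hn''), n', hn', List.mem_cons_self⟩

theorem app_app_app_s (M N P : Set GraphPt) :
    app (app (app s M) N) P = app (app M P) (app N P) := by
  rw [app_app_s]
  ext b
  constructor
  · rintro ⟨n, hn, n', b', h, hb⟩
    cases h
    exact app_mono (app_mono le_rfl hn) (app_mono le_rfl hn) hb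
  · rintro ⟨l, hl, n, hn, hb⟩
    obtain ⟨m, n', hm, hn', hl⟩ := exists_ofList_subset_app _ _ _ hl
    refine ⟨n ++ n', ?_, _, b, rfl, l, ?_, n, ?_, hb⟩
    · rw [ofList_append]
      exact Set.union_subset hn hn'
    · rw [ofList_append]
      exact hl.trans (app_mono hm Set.subset_union_right)
    · rw [ofList_append]
      exact Set.subset_union_left

theorem app_app_s_k_eq (M N : Set GraphPt) : app (app s k) M = app (app s k) N := by
  simp only [app_app_s, app_app_k]

theorem k_ne_app_s_k : k ≠ app s k := by
  intro h
  have h' : app (app k {base}) ∅ = app (app (app s k) {base}) ∅ := by rw [← h]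
  rw [app_app_k, app_app_app_s, app_app_k] at h'
  exact Set.singleton_ne_empty _ h'

end GraphPt

namespace CL

/-- The interpretation of CL-terms in the graph model. -/
def denote : CL → Set GraphPt
  | S => GraphPt.s
  | K => GraphPt.k
  | app M N => GraphPt.app M.denote N.denote

theorem Red.denote_eq {M N : CL} (h : Red M N) : M.denote = N.denote := by
  induction h with
  | sred M N X => exact GraphPt.app_app_app_s _ _ _
  | kred M N => exact GraphPt.app_app_k _ _
  | appL N _ ih => simp only [denote, ih]
  | appR M _ ih => simp only [denote, ih]

theorem denote_eq_of_reflTransGen {M N : CL} (h : Relation.ReflTransGen Red M N) :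
    M.denote = N.denote := by
  induction h with
  | refl => rfl
  | tail _ h ih => exact ih.trans h.denote_eq

theorem normalForm_S : S.NormalForm := by
  rintro ⟨_, ⟨⟩⟩

theorem normalForm_K : K.NormalForm := by
  rintro ⟨_, ⟨⟩⟩

theorem NormalForm.app_S_app {M N : CL} (hM : M.NormalForm) (hN : N.NormalForm) :
    (app (app S M) N).NormalForm := by
  rintro ⟨_, h⟩
  cases h with
  | appL _ h =>
    cases h with
    | appL _ h => cases h
    | appR _ h => exact hM ⟨_, h⟩
  | appR _ h => exact hN ⟨_, h⟩

end CL

/-- The structural equality predicate on normal forms is not representable in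
Combinatory Logic: there is no CL-term `E` such that for all CL-normal forms
`X` and `Y`, `E X Y →*_CL K` (true) if `X` and `Y` are syntactically identical,
and `E X Y →*_CL S K` (false) otherwise. -/
theorem no_structural_equality_in_CL :
    ¬ ∃ E : CL, ∀ X Y : CL, X.NormalForm → Y.NormalForm →
        (X = Y →
          Relation.ReflTransGen CL.Red (CL.app (CL.app E X) Y) CL.K) ∧
        (X ≠ Y →
          Relation.ReflTransGen CL.Red (CL.app (CL.app E X) Y) (CL.app CL.S CL.K)) := by
  rintro ⟨E, hE⟩
  have hKK := CL.normalForm_K.app_S_app CL.normalForm_K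
  have hKS := CL.normalForm_K.app_S_app CL.normalForm_S
  have h_true := CL.denote_eq_of_reflTransGen ((hE _ _ hKK hKK).1 rfl)
  have h_false := CL.denote_eq_of_reflTransGen ((hE _ _ hKK hKS).2 (by simp))
  simp only [CL.denote] at h_true h_false
  rw [GraphPt.app_app_s_k_eq GraphPt.s GraphPt.k] at h_false
  exact GraphPt.k_ne_app_s_k (h_true.symm.trans h_false)
end

section
/- The translation ⟦·⟧_@ from SF-calculus to Curryfied Applicative SF-calculus preserves reduction: if M →*_SF N then ⟦M⟧_@ →*_{SF@} ⟦N⟧_@. -/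
/-- Terms of Curryfied Applicative SF-calculus: constructors `S0`, `F0`
(nullary), `S1`, `F1` (unary), `S2`, `F2` (binary), and program symbols
`app` (binary) and `fRed` (f-reduce, ternary). -/
inductive SFA where
  | S0 : SFA
  | F0 : SFA
  | S1 : SFA → SFA
  | F1 : SFA → SFA
  | S2 : SFA → SFA → SFA
  | F2 : SFA → SFA → SFA
  | app : SFA → SFA → SFA
  | fRed : SFA → SFA → SFA → SFA

/-- One-step reduction of Curryfied Applicative SF-calculus: the contextual
closure of the twelve rewrite rules. -/
inductive SFA.Red : SFA → SFA → Prop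
  | appS0 (x : SFA) : SFA.Red (app S0 x) (S1 x)
  | appS1 (x y : SFA) : SFA.Red (app (S1 x) y) (S2 x y)
  | appS2 (x y z : SFA) : SFA.Red (app (S2 x y) z) (app (app x z) (app y z))
  | appF0 (x : SFA) : SFA.Red (app F0 x) (F1 x)
  | appF1 (x y : SFA) : SFA.Red (app (F1 x) y) (F2 x y)
  | appF2 (x y z : SFA) : SFA.Red (app (F2 x y) z) (fRed x y z)
  | fRedS0 (y z : SFA) : SFA.Red (fRed S0 y z) y
  | fRedF0 (y z : SFA) : SFA.Red (fRed F0 y z) y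
  | fRedS1 (x y z : SFA) : SFA.Red (fRed (S1 x) y z) (app (app z S0) x)
  | fRedF1 (x y z : SFA) : SFA.Red (fRed (F1 x) y z) (app (app z F0) x)
  | fRedS2 (p q y z : SFA) : SFA.Red (fRed (S2 p q) y z) (app (app z (app S0 p)) q)
  | fRedF2 (p q y z : SFA) : SFA.Red (fRed (F2 p q) y z) (app (app z (app F0 p)) q)
  | s1C {a a' : SFA} : SFA.Red a a' → SFA.Red (S1 a) (S1 a')
  | f1C {a a' : SFA} : SFA.Red a a' → SFA.Red (F1 a) (F1 a')
  | s2L {a a' : SFA} (b : SFA) : SFA.Red a a' → SFA.Red (S2 a b) (S2 a' b)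
  | s2R (a : SFA) {b b' : SFA} : SFA.Red b b' → SFA.Red (S2 a b) (S2 a b')
  | f2L {a a' : SFA} (b : SFA) : SFA.Red a a' → SFA.Red (F2 a b) (F2 a' b)
  | f2R (a : SFA) {b b' : SFA} : SFA.Red b b' → SFA.Red (F2 a b) (F2 a b')
  | appL {a a' : SFA} (b : SFA) : SFA.Red a a' → SFA.Red (app a b) (app a' b)
  | appR (a : SFA) {b b' : SFA} : SFA.Red b b' → SFA.Red (app a b) (app a b')
  | fRed1 {a a' : SFA} (b c : SFA) : SFA.Red a a' → SFA.Red (fRed a b c) (fRed a' b c)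
  | fRed2 (a : SFA) {b b' : SFA} (c : SFA) : SFA.Red b b' → SFA.Red (fRed a b c) (fRed a b' c)
  | fRed3 (a b : SFA) {c c' : SFA} : SFA.Red c c' → SFA.Red (fRed a b c) (fRed a b c')

/-- The translation `⟦·⟧_@` from SF-calculus to Curryfied Applicative
SF-calculus: `⟦S⟧ = S0`, `⟦F⟧ = F0`, `⟦M N⟧ = app ⟦M⟧ ⟦N⟧`. -/
def SF.toSFA : SF → SFA
  | .S => .S0
  | .F => .F0
  | .app M N => .app M.toSFA N.toSFA

open Relation in
/-- `F0` applied to three arguments unfolds to `fRed`. -/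
theorem SFA.reflTransGen_app_F0 (x y z : SFA) :
    ReflTransGen SFA.Red (app (app (app F0 x) y) z) (fRed x y z) :=
  .head (.appL z (.appL y (.appF0 x))) (.head (.appL z (.appF1 x y)) (.single (.appF2 x y z)))

open Relation in
/-- A single reduction step of SF-calculus is simulated by its translation. -/
theorem SF.Red.reflTransGen_toSFA {M N : SF} (h : SF.Red M N) :
    ReflTransGen SFA.Red M.toSFA N.toSFA := by
  induction h with
  | sred M N X =>
    exact .head (.appL _ (.appL _ (.appS0 _))) (.head (.appL _ (.appS1 _ _))
      (.single (.appS2 _ _ _)))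
  | fatomS M N => exact (SFA.reflTransGen_app_F0 _ _ _).tail (.fRedS0 _ _)
  | fatomF M N => exact (SFA.reflTransGen_app_F0 _ _ _).tail (.fRedF0 _ _)
  | fcomp P Q M N hPQ =>
    refine (SFA.reflTransGen_app_F0 _ _ _).trans ?_
    match P, hPQ with
    | .S, _ => exact .head (.fRed1 _ _ (.appS0 _)) (.single (.fRedS1 _ _ _))
    | .F, _ => exact .head (.fRed1 _ _ (.appF0 _)) (.single (.fRedF1 _ _ _))
    | .app .S P, _ =>
      exact .head (.fRed1 _ _ (.appL _ (.appS0 _))) (.head (.fRed1 _ _ (.appS1 _ _))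
        (.single (.fRedS2 _ _ _ _)))
    | .app .F P, _ =>
      exact .head (.fRed1 _ _ (.appL _ (.appF0 _))) (.head (.fRed1 _ _ (.appF1 _ _))
        (.single (.fRedF2 _ _ _ _)))
  | appL N _ ih => exact ih.lift (SFA.app · N.toSFA) fun _ _ => .appL _
  | appR M _ ih => exact ih.lift (SFA.app M.toSFA) fun _ _ => .appR _

/-- The translation `⟦·⟧_@` preserves reduction: if `M →*_SF N` then
`⟦M⟧_@ →*_{SF@} ⟦N⟧_@`. -/
theorem toSFA_preserves_reduction {M N : SF}
    (h : Relation.ReflTransGen SF.Red M N) :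
    Relation.ReflTransGen SFA.Red M.toSFA N.toSFA := by
  induction h with
  | refl => exact .refl
  | tail _ hstep ih => exact ih.trans hstep.reflTransGen_toSFA
end

section
/- Each single SF-reduction step is simulated by a nonempty reduction sequence in Curryfied Applicative SF-calculus: if M →_SF N in one step, then ⟦M⟧_@ reduces to ⟦N⟧_@ in one or more →_{SF@} steps. -/
namespace SFA

open Relation

theorem Red.transGen_appL {a a' : SFA} (b : SFA) (h : TransGen Red a a') :
    TransGen Red (app a b) (app a' b) :=
  h.lift (app · b) fun _ _ => Red.appL b

theorem Red.transGen_appR (a : SFA) {b b' : SFA} (h : TransGen Red b b') :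
    TransGen Red (app a b) (app a b') :=
  h.lift (app a) fun _ _ => Red.appR a

theorem Red.transGen_fRed1 {a a' : SFA} (b c : SFA) (h : TransGen Red a a') :
    TransGen Red (fRed a b c) (fRed a' b c) :=
  h.lift (fRed · b c) fun _ _ => Red.fRed1 b c

/-- `S0` applied to two arguments reduces to `S2`. -/
theorem Red.transGen_app_S0 (x y : SFA) : TransGen Red (app (app S0 x) y) (S2 x y) :=
  .head (.appL y (.appS0 x)) (.single (.appS1 x y))

/-- `F0` applied to two arguments reduces to `F2`. -/
theorem Red.transGen_app_F0 (x y : SFA) : TransGen Red (app (app F0 x) y) (F2 x y) :=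
  .head (.appL y (.appF0 x)) (.single (.appF1 x y))

/-- `F0` applied to three arguments reduces to `fRed`. -/
theorem Red.transGen_fRed (x y z : SFA) :
    TransGen Red (app (app (app F0 x) y) z) (fRed x y z) :=
  .tail (Red.transGen_appL z (Red.transGen_app_F0 x y)) (.appF2 x y z)

end SFA

/-- `fRed` on the translation of a factorable application splits it into its two parts. -/
theorem SF.Factorable.transGen_fRed {P Q : SF} (h : (SF.app P Q).Factorable) (y z : SFA) :
    Relation.TransGen SFA.Red (.fRed (SF.app P Q).toSFA y z)
      (.app (.app z P.toSFA) Q.toSFA) := by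
  match P, h with
  | .S, _ => exact .head (.fRed1 y z (.appS0 _)) (.single (.fRedS1 _ y z))
  | .F, _ => exact .head (.fRed1 y z (.appF0 _)) (.single (.fRedF1 _ y z))
  | .app .S _, _ =>
    exact .tail (SFA.Red.transGen_fRed1 y z (SFA.Red.transGen_app_S0 _ _)) (.fRedS2 _ _ y z)
  | .app .F _, _ =>
    exact .tail (SFA.Red.transGen_fRed1 y z (SFA.Red.transGen_app_F0 _ _)) (.fRedF2 _ _ y z)
  | .app (.app _ _) _, h => simp [SF.Factorable] at h

/-- Each single SF-reduction step is simulated by a nonempty reduction sequence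
in Curryfied Applicative SF-calculus: if `M →_SF N` in one step, then
`⟦M⟧_@` reduces to `⟦N⟧_@` in one or more `→_{SF@}` steps. -/
theorem toSFA_simulates_step {M N : SF} (h : SF.Red M N) :
    Relation.TransGen SFA.Red M.toSFA N.toSFA := by
  induction h with
  | sred M N X =>
    exact .tail (SFA.Red.transGen_appL _ (SFA.Red.transGen_app_S0 _ _)) (.appS2 _ _ _)
  | fatomS M N => exact .tail (SFA.Red.transGen_fRed _ _ _) (.fRedS0 _ _)
  | fatomF M N => exact .tail (SFA.Red.transGen_fRed _ _ _) (.fRedF0 _ _)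
  | fcomp P Q M N hPQ => exact .trans (SFA.Red.transGen_fRed _ _ _) (hPQ.transGen_fRed _ _)
  | appL N _ ih => exact SFA.Red.transGen_appL _ ih
  | appR M _ ih => exact SFA.Red.transGen_appR _ ih
end

section
/- If N is an SF-normal form, then its translation ⟦N⟧_@ is strongly normalising with respect to →_{SF@}. -/
namespace SFA

/-- Number of occurrences of `app`. -/
def appCount : SFA → ℕ
  | S0 => 0
  | F0 => 0
  | S1 a => a.appCount
  | F1 a => a.appCount
  | S2 a b => a.appCount + b.appCount
  | F2 a b => a.appCount + b.appCount
  | app a b => a.appCount + b.appCount + 1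
  | fRed a b c => a.appCount + b.appCount + c.appCount

/-- Behaviour of a term when it is applied to further arguments. -/
inductive Kind where
  /-- A combinator that accepts `n` more arguments without a duplicating or factoring step. -/
  | part (n : ℕ) : Kind
  /-- A term that becomes a stuck factorisation after `n` more arguments. -/
  | blocked (n : ℕ) : Kind

/-- Terms in which every saturated combinator is a factorisation of a stuck term. -/
inductive HasKind : Kind → SFA → Prop
  | S0 : HasKind (.part 2) S0
  | F0 : HasKind (.part 2) F0
  | S1 {k a} : HasKind k a → HasKind (.part 1) (S1 a)
  | F1 {k a} : HasKind k a → HasKind (.part 1) (F1 a)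
  | S2 {k l a b} : HasKind k a → HasKind l b → HasKind (.part 0) (S2 a b)
  | F2 {k l a b} : HasKind k a → HasKind l b → HasKind (.part 0) (F2 a b)
  | appPart {n k a b} : HasKind (.part (n + 1)) a → HasKind k b → HasKind (.part n) (app a b)
  | blockedF1 {a} : HasKind (.blocked 0) a → HasKind (.blocked 2) (F1 a)
  | blockedF2 {k a b} : HasKind (.blocked 0) a → HasKind k b → HasKind (.blocked 1) (F2 a b)
  | appF0 {a} : HasKind (.blocked 0) a → HasKind (.blocked 2) (app F0 a)
  | appBlocked {n k a b} : HasKind (.blocked (n + 1)) a → HasKind k b →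
      HasKind (.blocked n) (app a b)
  | appStuck {k a b} : HasKind (.blocked 0) a → HasKind k b → HasKind (.blocked 0) (app a b)
  | fRed {k l a b c} : HasKind (.blocked 0) a → HasKind k b → HasKind l c →
      HasKind (.blocked 0) (fRed a b c)

theorem HasKind.red {k : Kind} {a b : SFA} (ha : HasKind k a) (h : Red a b) :
    HasKind k b ∧ b.appCount < a.appCount := by
  induction ha generalizing b with
  | S0 => cases h
  | F0 => cases h
  | S1 ha iha =>
    cases h with
    | s1C h => exact ⟨.S1 (iha h).1, (iha h).2⟩
  | F1 ha iha =>
    cases h with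
    | f1C h => exact ⟨.F1 (iha h).1, (iha h).2⟩
  | S2 ha hb iha ihb =>
    cases h with
    | s2L _ h => exact ⟨.S2 (iha h).1 hb, by simpa [appCount] using (iha h).2⟩
    | s2R _ h => exact ⟨.S2 ha (ihb h).1, by simpa [appCount] using (ihb h).2⟩
  | F2 ha hb iha ihb =>
    cases h with
    | f2L _ h => exact ⟨.F2 (iha h).1 hb, by simpa [appCount] using (iha h).2⟩
    | f2R _ h => exact ⟨.F2 ha (ihb h).1, by simpa [appCount] using (ihb h).2⟩
  | appPart ha hb iha ihb =>
    cases h with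
    | appS0 => cases ha; exact ⟨.S1 hb, by simp [appCount]⟩
    | appF0 => cases ha; exact ⟨.F1 hb, by simp [appCount]⟩
    | appS1 => cases ha with | S1 ha => exact ⟨.S2 ha hb, by simp [appCount]⟩
    | appF1 => cases ha with | F1 ha => exact ⟨.F2 ha hb, by simp [appCount]⟩
    | appS2 => cases ha
    | appF2 => cases ha
    | appL _ h => exact ⟨.appPart (iha h).1 hb, by simpa [appCount] using (iha h).2⟩
    | appR _ h => exact ⟨.appPart ha (ihb h).1, by simpa [appCount] using (ihb h).2⟩
  | blockedF1 ha iha =>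
    cases h with
    | f1C h => exact ⟨.blockedF1 (iha h).1, (iha h).2⟩
  | blockedF2 ha hb iha ihb =>
    cases h with
    | f2L _ h => exact ⟨.blockedF2 (iha h).1 hb, by simpa [appCount] using (iha h).2⟩
    | f2R _ h => exact ⟨.blockedF2 ha (ihb h).1, by simpa [appCount] using (ihb h).2⟩
  | appF0 ha iha =>
    cases h with
    | appF0 => exact ⟨.blockedF1 ha, by simp [appCount]⟩
    | appL _ h => cases h
    | appR _ h => exact ⟨.appF0 (iha h).1, by simpa [appCount] using (iha h).2⟩
  | appBlocked ha hb iha ihb =>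
    cases h with
    | appF1 => cases ha with | blockedF1 ha => exact ⟨.blockedF2 ha hb, by simp [appCount]⟩
    | appF2 => cases ha with | blockedF2 ha ha' => exact ⟨.fRed ha ha' hb, by simp [appCount]⟩
    | appL _ h => exact ⟨.appBlocked (iha h).1 hb, by simpa [appCount] using (iha h).2⟩
    | appR _ h => exact ⟨.appBlocked ha (ihb h).1, by simpa [appCount] using (ihb h).2⟩
    | _ => cases ha
  | appStuck ha hb iha ihb =>
    cases h with
    | appL _ h => exact ⟨.appStuck (iha h).1 hb, by simpa [appCount] using (iha h).2⟩
    | appR _ h => exact ⟨.appStuck ha (ihb h).1, by simpa [appCount] using (ihb h).2⟩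
    | _ => cases ha
  | fRed ha hb hc iha ihb ihc =>
    cases h with
    | fRed1 _ _ h => exact ⟨.fRed (iha h).1 hb hc, by simpa [appCount] using (iha h).2⟩
    | fRed2 _ _ h => exact ⟨.fRed ha (ihb h).1 hc, by simpa [appCount] using (ihb h).2⟩
    | fRed3 _ _ h => exact ⟨.fRed ha hb (ihc h).1, by simpa [appCount] using (ihc h).2⟩
    | _ => cases ha

theorem HasKind.sn {k : Kind} {a : SFA} (ha : HasKind k a) : SN Red a := by
  rintro ⟨f, rfl, hf⟩
  have hk (n : ℕ) : HasKind k (f n) := by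
    induction n with
    | zero => exact ha
    | succ n ih => exact (ih.red (hf n)).1
  exact not_strictAnti_of_wellFoundedLT (fun n => (f n).appCount)
    (strictAnti_nat_of_succ_lt fun n => ((hk n).red (hf n)).2)

end SFA

namespace SF

open SFA (HasKind)

theorem NormalForm.left {M N : SF} (h : (app M N).NormalForm) : M.NormalForm :=
  fun ⟨_, r⟩ => h ⟨_, .appL N r⟩

theorem NormalForm.right {M N : SF} (h : (app M N).NormalForm) : N.NormalForm :=
  fun ⟨_, r⟩ => h ⟨_, .appR M r⟩

theorem NormalForm.not_factorable {P M N : SF}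
    (h : (app (app (app F P) M) N).NormalForm) : ¬ P.Factorable := by
  intro hP
  cases P with
  | S => exact h ⟨_, .fatomS M N⟩
  | F => exact h ⟨_, .fatomF M N⟩
  | app P Q => exact h ⟨_, .fcomp P Q M N hP⟩

/-- The translation of a normal form has a kind, and is stuck unless the normal form is
factorable. -/
theorem NormalForm.hasKind_toSFA : {N : SF} → N.NormalForm →
    (∃ k, HasKind k N.toSFA) ∧ (¬ N.Factorable → HasKind (.blocked 0) N.toSFA)
  | S, _ => ⟨⟨_, .S0⟩, fun h => (h trivial).elim⟩
  | F, _ => ⟨⟨_, .F0⟩, fun h => (h trivial).elim⟩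
  | app S _, h =>
    have ⟨_, hM⟩ := (hasKind_toSFA h.right).1
    ⟨⟨_, .appPart .S0 hM⟩, fun h => (h trivial).elim⟩
  | app F _, h =>
    have ⟨_, hM⟩ := (hasKind_toSFA h.right).1
    ⟨⟨_, .appPart .F0 hM⟩, fun h => (h trivial).elim⟩
  | app (app S _) _, h =>
    have ⟨_, hM⟩ := (hasKind_toSFA h.left.right).1
    have ⟨_, hN⟩ := (hasKind_toSFA h.right).1
    ⟨⟨_, .appPart (.appPart .S0 hM) hN⟩, fun h => (h trivial).elim⟩
  | app (app F _) _, h =>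
    have ⟨_, hM⟩ := (hasKind_toSFA h.left.right).1
    have ⟨_, hN⟩ := (hasKind_toSFA h.right).1
    ⟨⟨_, .appPart (.appPart .F0 hM) hN⟩, fun h => (h trivial).elim⟩
  | app (app (app S M) N) X, h => (h ⟨_, .sred M N X⟩).elim
  | app (app (app F _) _) _, h =>
    have hP := (hasKind_toSFA h.left.left.right).2 h.not_factorable
    have ⟨_, hM⟩ := (hasKind_toSFA h.left.right).1
    have ⟨_, hN⟩ := (hasKind_toSFA h.right).1
    have stuck := HasKind.appBlocked (.appBlocked (.appF0 hP) hM) hN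
    ⟨⟨_, stuck⟩, fun _ => stuck⟩
  | app (app (app (app _ _) _) _) _, h =>
    have hM := (hasKind_toSFA h.left).2 id
    have ⟨_, hN⟩ := (hasKind_toSFA h.right).1
    ⟨⟨_, .appStuck hM hN⟩, fun _ => .appStuck hM hN⟩

end SF

/-- If `N` is an SF-normal form, then `⟦N⟧_@` is strongly normalising with
respect to `→_{SF@}`. -/
theorem toSFA_of_normalForm_SN {N : SF} (h : N.NormalForm) :
    SN SFA.Red N.toSFA := by
  have ⟨_, hN⟩ := h.hasKind_toSFA.1
  exact hN.sn
end

section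
/- The translation ⟦·⟧_@ preserves strong normalisation: if an SF-term M is strongly normalising with respect to →_SF, then ⟦M⟧_@ is strongly normalising with respect to →_{SF@}. -/
theorem sn_iff_acc {α : Type*} {r : α → α → Prop} {a : α} :
    SN r a ↔ Acc (fun x y => r y x) a := by
  rw [SN, ← not_iff_not, not_not, not_acc_iff_exists_descending_chain]

/-- Readback of Curryfied Applicative SF-calculus into SF-calculus. -/
def SFA.toSF : SFA → SF
  | .S0 => .S
  | .F0 => .F
  | .S1 x => .app .S x.toSF
  | .F1 x => .app .F x.toSF
  | .S2 x y => .app (.app .S x.toSF) y.toSF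
  | .F2 x y => .app (.app .F x.toSF) y.toSF
  | .app x y => .app x.toSF y.toSF
  | .fRed x y z => .app (.app (.app .F x.toSF) y.toSF) z.toSF

theorem SF.toSF_toSFA (M : SF) : M.toSFA.toSF = M := by
  induction M <;> simp_all [SF.toSFA, SFA.toSF]

/-- The number of occurrences of the program symbol `app`. -/
def SFA.appCount_s12 : SFA → ℕ
  | .S0 => 0
  | .F0 => 0
  | .S1 x => x.appCount_s12
  | .F1 x => x.appCount_s12
  | .S2 x y => x.appCount_s12 + y.appCount_s12
  | .F2 x y => x.appCount_s12 + y.appCount_s12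
  | .app x y => x.appCount_s12 + y.appCount_s12 + 1
  | .fRed x y z => x.appCount_s12 + y.appCount_s12 + z.appCount_s12

/-- Each step is either simulated by an SF-step or administrative: it leaves the readback unchanged
and consumes an `app`. -/
theorem SFA.Red.toSF_red_or {a b : SFA} (h : SFA.Red a b) :
    SF.Red a.toSF b.toSF ∨ a.toSF = b.toSF ∧ b.appCount_s12 < a.appCount_s12 := by
  induction h with
  | appS0 | appS1 | appF0 | appF1 | appF2 =>
    exact .inr ⟨rfl, by simp only [SFA.appCount_s12]; omega⟩
  | appS2 => exact .inl (.sred _ _ _)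
  | fRedS0 => exact .inl (.fatomS _ _)
  | fRedF0 => exact .inl (.fatomF _ _)
  | fRedS1 | fRedF1 | fRedS2 | fRedF2 => exact .inl (.fcomp _ _ _ _ trivial)
  | s1C _ ih | f1C _ ih | s2R _ _ ih | f2R _ _ ih | appR _ _ ih | fRed3 _ _ _ ih =>
    refine ih.imp (.appR _) fun ⟨e, l⟩ => ⟨?_, ?_⟩
    · simp only [SFA.toSF, e]
    · simpa only [SFA.appCount_s12, add_lt_add_iff_left, add_lt_add_iff_right] using l
  | s2L _ _ ih | f2L _ _ ih | fRed2 _ _ _ ih =>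
    refine ih.imp (fun r => ?_) fun ⟨e, l⟩ => ⟨?_, ?_⟩
    · exact .appL _ (.appR _ r)
    · simp only [SFA.toSF, e]
    · simpa only [SFA.appCount_s12, add_lt_add_iff_left, add_lt_add_iff_right] using l
  | appL _ _ ih =>
    refine ih.imp (.appL _) fun ⟨e, l⟩ => ⟨?_, ?_⟩
    · simp only [SFA.toSF, e]
    · simpa only [SFA.appCount_s12, add_lt_add_iff_right] using l
  | fRed1 _ _ _ ih =>
    refine ih.imp (fun r => ?_) fun ⟨e, l⟩ => ⟨?_, ?_⟩
    · exact .appL _ (.appL _ (.appR _ r))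
    · simp only [SFA.toSF, e]
    · simpa only [SFA.appCount_s12, add_lt_add_iff_right] using l

theorem SFA.sn_of_sn_toSF {a : SFA} (h : SN SF.Red a.toSF) : SN SFA.Red a := by
  rw [sn_iff_acc] at h ⊢
  have key : Acc (Prod.Lex (fun x y => SF.Red y x) (· < ·)) (a.toSF, a.appCount_s12) :=
    Prod.lexAccessible h (fun n => wellFounded_lt.apply n) _
  refine Subrelation.accessible (fun {x y} hr => ?_)
    (InvImage.accessible (fun x : SFA => (x.toSF, x.appCount_s12)) key)
  exact Prod.lex_def.2 (hr.toSF_red_or.imp id fun ⟨e, l⟩ => ⟨e.symm, l⟩)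

/-- The translation `⟦·⟧_@` preserves strong normalisation: if `M` is strongly
normalising w.r.t. `→_SF`, then `⟦M⟧_@` is strongly normalising w.r.t.
`→_{SF@}`. -/
theorem toSFA_preserves_SN {M : SF} (h : SN SF.Red M) :
    SN SFA.Red M.toSFA := by
  exact SFA.sn_of_sn_toSF (M.toSF_toSFA.symm ▸ h)
end

section
/- The reduction relation →_{SF@} of Curryfied Applicative SF-calculus is confluent: if t →*_{SF@} s₁ and t →*_{SF@} s₂, then there exists u with s₁ →*_{SF@} u and s₂ →*_{SF@} u. -/
namespace SFA

/-- Parallel reduction: simultaneous contraction of a set of redexes of a term. -/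
inductive Par : SFA → SFA → Prop
  | S0 : Par S0 S0
  | F0 : Par F0 F0
  | S1 {x x' : SFA} : Par x x' → Par (S1 x) (S1 x')
  | F1 {x x' : SFA} : Par x x' → Par (F1 x) (F1 x')
  | S2 {x x' y y' : SFA} : Par x x' → Par y y' → Par (S2 x y) (S2 x' y')
  | F2 {x x' y y' : SFA} : Par x x' → Par y y' → Par (F2 x y) (F2 x' y')
  | app {x x' y y' : SFA} : Par x x' → Par y y' → Par (app x y) (app x' y')
  | fRed {x x' y y' z z' : SFA} :
      Par x x' → Par y y' → Par z z' → Par (fRed x y z) (fRed x' y' z')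
  | appS0 {x x' : SFA} : Par x x' → Par (app SFA.S0 x) (SFA.S1 x')
  | appS1 {x x' y y' : SFA} :
      Par x x' → Par y y' → Par (app (SFA.S1 x) y) (SFA.S2 x' y')
  | appS2 {x x' y y' z z' : SFA} : Par x x' → Par y y' → Par z z' →
      Par (app (SFA.S2 x y) z) (SFA.app (SFA.app x' z') (SFA.app y' z'))
  | appF0 {x x' : SFA} : Par x x' → Par (app SFA.F0 x) (SFA.F1 x')
  | appF1 {x x' y y' : SFA} :
      Par x x' → Par y y' → Par (app (SFA.F1 x) y) (SFA.F2 x' y')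
  | appF2 {x x' y y' z z' : SFA} : Par x x' → Par y y' → Par z z' →
      Par (app (SFA.F2 x y) z) (SFA.fRed x' y' z')
  | fRedS0 {y y' : SFA} (z : SFA) : Par y y' → Par (fRed SFA.S0 y z) y'
  | fRedF0 {y y' : SFA} (z : SFA) : Par y y' → Par (fRed SFA.F0 y z) y'
  | fRedS1 {x x' z z' : SFA} (y : SFA) : Par x x' → Par z z' →
      Par (fRed (SFA.S1 x) y z) (SFA.app (SFA.app z' SFA.S0) x')
  | fRedF1 {x x' z z' : SFA} (y : SFA) : Par x x' → Par z z' →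
      Par (fRed (SFA.F1 x) y z) (SFA.app (SFA.app z' SFA.F0) x')
  | fRedS2 {p p' q q' z z' : SFA} (y : SFA) : Par p p' → Par q q' → Par z z' →
      Par (fRed (SFA.S2 p q) y z) (SFA.app (SFA.app z' (SFA.app SFA.S0 p')) q')
  | fRedF2 {p p' q q' z z' : SFA} (y : SFA) : Par p p' → Par q q' → Par z z' →
      Par (fRed (SFA.F2 p q) y z) (SFA.app (SFA.app z' (SFA.app SFA.F0 p')) q')

/-- The complete development of a term: contraction of all its redexes at once. -/
def dev : SFA → SFA
  | S0 => S0
  | F0 => F0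
  | S1 x => S1 (dev x)
  | F1 x => F1 (dev x)
  | S2 x y => S2 (dev x) (dev y)
  | F2 x y => F2 (dev x) (dev y)
  | app S0 x => S1 (dev x)
  | app (S1 x) y => S2 (dev x) (dev y)
  | app (S2 x y) z => app (app (dev x) (dev z)) (app (dev y) (dev z))
  | app F0 x => F1 (dev x)
  | app (F1 x) y => F2 (dev x) (dev y)
  | app (F2 x y) z => fRed (dev x) (dev y) (dev z)
  | app x y => app (dev x) (dev y)
  | fRed S0 y _ => dev y
  | fRed F0 y _ => dev y
  | fRed (S1 x) _ z => app (app (dev z) S0) (dev x)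
  | fRed (F1 x) _ z => app (app (dev z) F0) (dev x)
  | fRed (S2 p q) _ z => app (app (dev z) (app S0 (dev p))) (dev q)
  | fRed (F2 p q) _ z => app (app (dev z) (app F0 (dev p))) (dev q)
  | fRed x y z => fRed (dev x) (dev y) (dev z)

theorem Par.refl (t : SFA) : Par t t := by
  induction t <;> constructor <;> assumption

theorem Red.par {t s : SFA} (h : Red t s) : Par t s := by
  induction h with
  | appS2 x y z => exact .appS2 (.refl x) (.refl y) (.refl z)
  | _ => constructor <;> first | assumption | exact Par.refl _

/-- The triangle property of parallel reduction. -/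
theorem Par.par_dev {t s : SFA} (h : Par t s) : Par s (dev t) := by
  induction h with
  | @app x x' y y' hx hy ihx ihy =>
    cases x <;> simp only [dev] at ihx ⊢
    case app => exact .app ihx ihy
    case fRed => exact .app ihx ihy
    case S2 =>
      cases hx with | S2 => cases ihx with | S2 hp hq => exact .appS2 hp hq ihy
    all_goals cases hx; cases ihx; constructor <;> assumption
  | @fRed x x' y y' z z' hx hy hz ihx ihy ihz =>
    cases x <;> simp only [dev] at ihx ⊢
    case app => exact .fRed ihx ihy ihz
    case fRed => exact .fRed ihx ihy ihz
    all_goals cases hx; cases ihx; constructor <;> assumption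
  | _ => simp only [dev]; repeat' first | assumption | apply_rules [Par.S0, Par.F0, Par.S1, Par.F1,
      Par.S2, Par.F2, Par.app, Par.fRed]

open Relation

theorem reds_S1 {x x' : SFA} (hx : ReflTransGen Red x x') : ReflTransGen Red (S1 x) (S1 x') :=
  hx.lift S1 fun _ _ => Red.s1C

theorem reds_F1 {x x' : SFA} (hx : ReflTransGen Red x x') : ReflTransGen Red (F1 x) (F1 x') :=
  hx.lift F1 fun _ _ => Red.f1C

theorem reds_S2 {x x' y y' : SFA} (hx : ReflTransGen Red x x') (hy : ReflTransGen Red y y') :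
    ReflTransGen Red (S2 x y) (S2 x' y') :=
  (hx.lift (S2 · y) fun _ _ => Red.s2L y).trans (hy.lift (S2 x') fun _ _ => Red.s2R x')

theorem reds_F2 {x x' y y' : SFA} (hx : ReflTransGen Red x x') (hy : ReflTransGen Red y y') :
    ReflTransGen Red (F2 x y) (F2 x' y') :=
  (hx.lift (F2 · y) fun _ _ => Red.f2L y).trans (hy.lift (F2 x') fun _ _ => Red.f2R x')

theorem reds_app {x x' y y' : SFA} (hx : ReflTransGen Red x x') (hy : ReflTransGen Red y y') :
    ReflTransGen Red (app x y) (app x' y') :=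
  (hx.lift (app · y) fun _ _ => Red.appL y).trans (hy.lift (app x') fun _ _ => Red.appR x')

theorem reds_fRed {x x' y y' z z' : SFA} (hx : ReflTransGen Red x x')
    (hy : ReflTransGen Red y y') (hz : ReflTransGen Red z z') :
    ReflTransGen Red (fRed x y z) (fRed x' y' z') :=
  ((hx.lift (fRed · y z) fun _ _ => Red.fRed1 y z).trans
    (hy.lift (fRed x' · z) fun _ _ => Red.fRed2 x' z)).trans
    (hz.lift (fRed x' y') fun _ _ => Red.fRed3 x' y')

theorem Par.reds {t s : SFA} (h : Par t s) : ReflTransGen Red t s := by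
  induction h with
  | S0 => exact .refl
  | F0 => exact .refl
  | S1 _ hx => exact reds_S1 hx
  | F1 _ hx => exact reds_F1 hx
  | S2 _ _ hx hy => exact reds_S2 hx hy
  | F2 _ _ hx hy => exact reds_F2 hx hy
  | app _ _ hx hy => exact reds_app hx hy
  | fRed _ _ _ hx hy hz => exact reds_fRed hx hy hz
  | appS0 _ hx => exact .head (.appS0 _) (reds_S1 hx)
  | appS1 _ _ hx hy => exact .head (.appS1 _ _) (reds_S2 hx hy)
  | appS2 _ _ _ hx hy hz =>
    exact .head (.appS2 _ _ _) (reds_app (reds_app hx hz) (reds_app hy hz))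
  | appF0 _ hx => exact .head (.appF0 _) (reds_F1 hx)
  | appF1 _ _ hx hy => exact .head (.appF1 _ _) (reds_F2 hx hy)
  | appF2 _ _ _ hx hy hz => exact .head (.appF2 _ _ _) (reds_fRed hx hy hz)
  | fRedS0 _ _ hy => exact .head (.fRedS0 _ _) hy
  | fRedF0 _ _ hy => exact .head (.fRedF0 _ _) hy
  | fRedS1 _ _ _ hx hz => exact .head (.fRedS1 _ _ _) (reds_app (reds_app hz .refl) hx)
  | fRedF1 _ _ _ hx hz => exact .head (.fRedF1 _ _ _) (reds_app (reds_app hz .refl) hx)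
  | fRedS2 _ _ _ _ hp hq hz =>
    exact .head (.fRedS2 _ _ _ _) (reds_app (reds_app hz (reds_app .refl hp)) hq)
  | fRedF2 _ _ _ _ hp hq hz =>
    exact .head (.fRedF2 _ _ _ _) (reds_app (reds_app hz (reds_app .refl hp)) hq)

theorem reds_of_reflTransGen_par {t s : SFA} (h : ReflTransGen Par t s) :
    ReflTransGen Red t s := by
  induction h with
  | refl => exact .refl
  | tail _ h ih => exact ih.trans h.reds

end SFA

/-- The reduction relation `→_{SF@}` of Curryfied Applicative SF-calculus is
confluent. -/
theorem SFA.red_confluent {t s₁ s₂ : SFA}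
    (h₁ : Relation.ReflTransGen SFA.Red t s₁)
    (h₂ : Relation.ReflTransGen SFA.Red t s₂) :
    ∃ u : SFA, Relation.ReflTransGen SFA.Red s₁ u ∧
      Relation.ReflTransGen SFA.Red s₂ u := by
  obtain ⟨u, hu₁, hu₂⟩ := Relation.church_rosser
    (fun a _ _ (hb : Par a _) hc => ⟨dev a, .single hb.par_dev, .single hc.par_dev⟩)
    (h₁.lift id fun _ _ => Red.par) (h₂.lift id fun _ _ => Red.par)
  exact ⟨u, reds_of_reflTransGen_par hu₁, reds_of_reflTransGen_par hu₂⟩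
end
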